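/- Let B = (A, R) be a blueprint and ∼ a prime congruence on B. Then its absorbing ideal I_∼ = { e ∈ A : e·b ∼ e for all b ∈ A } is a prime ideal of B. -/

import Mathlib

/-! Congruences on a blueprint `B = (A, R)`, where `R` is a pre-addition, i.e. a semiring
congruence (`RingCon`) on the monoid semiring `ℕ[A] = MonoidAlgebra ℕ A`. -/

/-- `x` and `y` are termwise related sums: `x = Σ aᵢ`, `y = Σ bᵢ` with `r aᵢ bᵢ` for all `i`. -/
def Blueprint.Termwise {A : Type*} [CommMonoid A] (r : A → A → Prop)
    (x y : MonoidAlgebra ℕ A) : Prop :=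
  ∃ l : List (A × A), (∀ p ∈ l, r p.1 p.2) ∧
    x = (l.map fun p => MonoidAlgebra.of ℕ A p.1).sum ∧
    y = (l.map fun p => MonoidAlgebra.of ℕ A p.2).sum

/-- The linear extension `∼_ℕ` of a relation `∼` on `A` to `ℕ[A]`: the smallest equivalence
relation such that `Σ aᵢ ∼_ℕ Σ bᵢ` whenever `aᵢ ∼ bᵢ` termwise. -/
def Blueprint.LinExt {A : Type*} [CommMonoid A] (r : A → A → Prop) :
    MonoidAlgebra ℕ A → MonoidAlgebra ℕ A → Prop :=
  Relation.EqvGen (Blueprint.Termwise r)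

/-- `∼_R`: the smallest equivalence relation on `ℕ[A]` containing both `R` and `∼_ℕ`. -/
def Blueprint.SimR {A : Type*} [CommMonoid A] (R : RingCon (MonoidAlgebra ℕ A))
    (r : A → A → Prop) : MonoidAlgebra ℕ A → MonoidAlgebra ℕ A → Prop :=
  Relation.EqvGen (fun x y => R x y ∨ Blueprint.LinExt r x y)

/-- A congruence on the blueprint `(A, R)`: an equivalence relation `∼` on `A` such that
(C1) `∼_ℕ` is a pre-addition (additive and multiplicative) and (C2) the restriction of
`∼_R` to `A` equals `∼`. -/
structure Blueprint.IsCongruence {A : Type*} [CommMonoid A]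
    (R : RingCon (MonoidAlgebra ℕ A)) (r : A → A → Prop) : Prop where
  equiv : Equivalence r
  lin_add : ∀ x x' y y' : MonoidAlgebra ℕ A, Blueprint.LinExt r x x' →
    Blueprint.LinExt r y y' → Blueprint.LinExt r (x + y) (x' + y')
  lin_mul : ∀ x x' y y' : MonoidAlgebra ℕ A, Blueprint.LinExt r x x' →
    Blueprint.LinExt r y y' → Blueprint.LinExt r (x * y) (x' * y')
  restrict : ∀ a b : A,
    Blueprint.SimR R r (MonoidAlgebra.of ℕ A a) (MonoidAlgebra.of ℕ A b) ↔ r a b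

/-- A finite chain `x ≡ Σc₁ ∼_ℕ Σd₁ ≡ Σc₂ ∼_ℕ ⋯ ∼_ℕ Σdₙ ≡ y` alternating between the
pre-addition `R` and the linear extension `∼_ℕ` of `∼`. -/
def Blueprint.ChainRel {A : Type*} [CommMonoid A] (R : RingCon (MonoidAlgebra ℕ A))
    (r : A → A → Prop) (x y : MonoidAlgebra ℕ A) : Prop :=
  ∃ z : MonoidAlgebra ℕ A, R x z ∧
    Relation.ReflTransGen (fun u v => ∃ w, Blueprint.LinExt r u w ∧ R w v) z y

/-- The equivalence relation `∼^I` on `A` associated to a subset `I ⊆ A`: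
`a ∼^I b` iff `a = b` or `a, b ∈ I`. -/
def Blueprint.relOfSet {A : Type*} (I : Set A) : A → A → Prop :=
  fun a b => a = b ∨ (a ∈ I ∧ b ∈ I)

/-- The relation `∼_I` on `A`: the restriction to `A` of the smallest equivalence relation
on `ℕ[A]` containing `R` and the linear extension of `∼^I`. -/
def Blueprint.SimI {A : Type*} [CommMonoid A] (R : RingCon (MonoidAlgebra ℕ A))
    (I : Set A) : A → A → Prop :=
  fun a b => Blueprint.SimR R (Blueprint.relOfSet I)
    (MonoidAlgebra.of ℕ A a) (MonoidAlgebra.of ℕ A b)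

/-- An ideal of the blueprint `B = (A, R)`. -/
structure Blueprint.IsIdeal {A : Type*} [CommMonoid A]
    (R : RingCon (MonoidAlgebra ℕ A)) (I : Set A) : Prop where
  mul_mem : ∀ a ∈ I, ∀ b : A, a * b ∈ I
  zero_mem : ∀ e : A, R (MonoidAlgebra.of ℕ A e) 0 → e ∈ I
  closed : ∀ a b : A, Blueprint.SimI R I a b → b ∈ I → a ∈ I

/-- A prime ideal: an ideal whose complement is a multiplicative subset containing `1`. -/
structure Blueprint.IsPrimeIdeal {A : Type*} [CommMonoid A]
    (R : RingCon (MonoidAlgebra ℕ A)) (I : Set A) : Prop where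
  isIdeal : Blueprint.IsIdeal R I
  one_not_mem : (1 : A) ∉ I
  mul_not_mem : ∀ a b : A, a ∉ I → b ∉ I → a * b ∉ I

/-- A prime congruence: a proper congruence (one with more than one equivalence class)
such that `ab ∼ ac` implies `b ∼ c` or `a ∼ e` for some zero `e ≡ 0`. -/
structure Blueprint.IsPrimeCongruence {A : Type*} [CommMonoid A]
    (R : RingCon (MonoidAlgebra ℕ A)) (r : A → A → Prop) : Prop where
  isCongruence : Blueprint.IsCongruence R r
  proper : ∃ a b : A, ¬ r a b
  prime : ∀ a b c : A, r (a * b) (a * c) →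
    r b c ∨ ∃ e : A, R (MonoidAlgebra.of ℕ A e) 0 ∧ r a e

namespace Blueprint

variable {A : Type*} [CommMonoid A] {R : RingCon (MonoidAlgebra ℕ A)} {r s : A → A → Prop}

theorem Termwise.mono (h : ∀ a b, r a b → s a b) {x y : MonoidAlgebra ℕ A}
    (hxy : Termwise r x y) : Termwise s x y := by
  obtain ⟨l, hl, hx, hy⟩ := hxy
  exact ⟨l, fun p hp => h _ _ (hl p hp), hx, hy⟩

theorem LinExt.mono (h : ∀ a b, r a b → s a b) {x y : MonoidAlgebra ℕ A}
    (hxy : LinExt r x y) : LinExt s x y :=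
  Relation.EqvGen.mono (fun _ _ => Termwise.mono h) x y hxy

theorem SimR.mono (h : ∀ a b, r a b → s a b) {x y : MonoidAlgebra ℕ A}
    (hxy : SimR R r x y) : SimR R s x y :=
  Relation.EqvGen.mono (fun _ _ => Or.imp_right (LinExt.mono h)) x y hxy

theorem LinExt.of {a b : A} (h : r a b) :
    LinExt r (MonoidAlgebra.of ℕ A a) (MonoidAlgebra.of ℕ A b) :=
  .rel _ _ ⟨[(a, b)], by simpa using h, by simp, by simp⟩

namespace IsCongruence

theorem mul_right (hr : IsCongruence R r) {a b : A} (h : r a b) (c : A) :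
    r (a * c) (b * c) := by
  refine (hr.restrict _ _).1 (.rel _ _ (.inr ?_))
  rw [map_mul, map_mul]
  exact hr.lin_mul _ _ _ _ (LinExt.of h) (LinExt.of (hr.equiv.refl c))

theorem absorbing_of_zero (hr : IsCongruence R r) {e : A}
    (he : R (MonoidAlgebra.of ℕ A e) 0) (b : A) : r (e * b) e := by
  refine (hr.restrict _ _).1 (.rel _ _ (.inl ?_))
  rw [map_mul]
  have h := R.mul he (R.refl (MonoidAlgebra.of ℕ A b))
  rw [zero_mul] at h
  exact R.trans h (R.symm he)

theorem absorbing_of_rel (hr : IsCongruence R r) {a e : A} (h : r a e)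
    (he : ∀ b, r (e * b) e) (b : A) : r (a * b) a :=
  hr.equiv.trans (hr.mul_right h b) (hr.equiv.trans (he b) (hr.equiv.symm h))

theorem rel_of_absorbing (hr : IsCongruence R r) {e f : A}
    (he : ∀ b, r (e * b) e) (hf : ∀ b, r (f * b) f) : r e f :=
  hr.equiv.trans (hr.equiv.symm (he f)) (mul_comm f e ▸ hf e)

theorem isIdeal_absorbing (hr : IsCongruence R r) :
    IsIdeal R {e : A | ∀ b : A, r (e * b) e} where
  mul_mem _ ha b := hr.absorbing_of_rel (ha b) ha
  zero_mem _ he := hr.absorbing_of_zero he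
  closed a b hab hb := by
    refine hr.absorbing_of_rel ((hr.restrict a b).1 (SimR.mono ?_ hab)) hb
    rintro x y (rfl | ⟨hx, hy⟩)
    · exact hr.equiv.refl x
    · exact hr.rel_of_absorbing hx hy

end IsCongruence

end Blueprint

/-- If `∼` is a prime congruence on the blueprint `B = (A, R)`, then its
absorbing ideal `I_∼ = { e ∈ A : e·b ∼ e for all b ∈ A }` is a prime ideal of `B`. -/
theorem blueprint_absorbingIdeal_of_prime_isPrime {A : Type*} [CommMonoid A]
    (R : RingCon (MonoidAlgebra ℕ A)) (r : A → A → Prop)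
    (hp : Blueprint.IsPrimeCongruence R r) :
    Blueprint.IsPrimeIdeal R {e : A | ∀ b : A, r (e * b) e} := by
  have hr := hp.isCongruence
  refine ⟨hr.isIdeal_absorbing, fun h => ?_, fun a b ha hb hab => hb fun c => ?_⟩
  · obtain ⟨a, b, hab⟩ := hp.proper
    have h1 (c : A) : r c 1 := one_mul c ▸ h c
    exact hab (hr.equiv.trans (h1 a) (hr.equiv.symm (h1 b)))
  · rcases hp.prime a (b * c) b (mul_assoc a b c ▸ hab c) with h | ⟨e, he, hae⟩
    · exact h
    · exact absurd (hr.absorbing_of_rel hae (hr.absorbing_of_zero he)) ha
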